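/- arXiv:1612.02615 — 7 statements merged into one kernel-verified Lean document; each statement's English description precedes it below -/
import Mathlib

section
/- Let a₁, a₂, a₃ > 0 and β ∈ [0, π]. Then every positive real number ω of one of the following forms belongs to the dispersion set Σ(β): ω = πn/a₁ with n ∈ ℕ, n ≥ 1; ω = πn/a₂ with n ∈ ℕ, n ≥ 1; ω = (β + 2πn)/a₃ with n ∈ ℤ and ω > 0; ω = (2πn − β)/a₃ with n ∈ ℤ and ω > 0. (In other words, σ₁ ∪ σ₂ ∪ σ₃ is contained in the essential spectrum, where σᵢ = {(πn/aᵢ)² : n ∈ ℤ} for i = 1, 2 and σ₃ = {((±β + 2πn)/a₃)² : n ∈ ℤ}.) -/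
open Real MeasureTheory Set Filter Topology

noncomputable section

/-- The dispersion relation `D_β(ω, k₁, k₂)`. -/
def Dfun (a₁ a₂ a₃ β ω k₁ k₂ : ℝ) : ℝ :=
  Real.sin (ω * a₂) * Real.sin (ω * a₃) * (Real.cos (ω * a₁) - Real.cos k₁)
    + Real.sin (ω * a₃) * Real.sin (ω * a₁) * (Real.cos (ω * a₂) - Real.cos k₂)
    + Real.sin (ω * a₁) * Real.sin (ω * a₂) * (Real.cos (ω * a₃) - Real.cos β)

/-- The dispersion set `Σ(β)`. -/
def dispSet (a₁ a₂ a₃ β : ℝ) : Set ℝ :=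
  {ω | 0 < ω ∧ ∃ k₁ ∈ Icc (0 : ℝ) π, ∃ k₂ ∈ Icc (0 : ℝ) π, Dfun a₁ a₂ a₃ β ω k₁ k₂ = 0}

/-- `φ_β(ω) = (cos(ω a₃) − cos β)/sin(ω a₃)`. -/
def phiB (a₃ β ω : ℝ) : ℝ := (Real.cos (ω * a₃) - Real.cos β) / Real.sin (ω * a₃)

/-- `f(ξ, η, ω)`. -/
def fFun (a₁ a₂ ξ η ω : ℝ) : ℝ :=
  (Real.cos ξ - Real.cos (ω * a₁)) / Real.sin (ω * a₁)
    + (Real.cos η - Real.cos (ω * a₂)) / Real.sin (ω * a₂)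

/-- `g_β(ω)`. -/
def gB (a₁ a₂ a₃ β ω : ℝ) : ℝ :=
  Real.cos (ω * a₁) / Real.sin (ω * a₁) + Real.cos (ω * a₂) / Real.sin (ω * a₂)
    + phiB a₃ β ω

/-- The set `T = {πn/a₁ : n ≥ 1} ∪ {πn/a₂ : n ≥ 1}`. -/
def Tset (a₁ a₂ : ℝ) : Set ℝ :=
  {x | ∃ n : ℕ, 1 ≤ n ∧ x = π * n / a₁} ∪ {x | ∃ n : ℕ, 1 ≤ n ∧ x = π * n / a₂}

/-- The set `𝒲(β)`. -/
def Wset (a₃ β : ℝ) : Set ℝ :=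
  if β = 0 ∨ β = π then
    {x | ∃ n : ℕ, 1 ≤ n ∧ x = β / a₃ + (2 * n + 1) * π / a₃}
  else
    {x | ∃ n : ℕ, 1 ≤ n ∧ x = π * n / a₃}

/-- `(ω_b, ω_t)` is a gap of the dispersion set `Σ(β)`. -/
def IsGap (a₁ a₂ a₃ β ωb ωt : ℝ) : Prop :=
  0 < ωb ∧ ωb < ωt ∧ ωb ∈ dispSet a₁ a₂ a₃ β ∧ ωt ∈ dispSet a₁ a₂ a₃ β ∧
    Ioo ωb ωt ∩ dispSet a₁ a₂ a₃ β = ∅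

/-- The finite-difference system (FD). -/
def SatisfiesFD (a₁ a₂ a₃ β μ ω : ℝ) (u : ℤ × ℤ → ℂ) : Prop :=
  (∀ k ℓ : ℤ, (k, ℓ) ≠ ((0 : ℤ), (0 : ℤ)) →
    u (k + 1, ℓ) / (Real.sin (ω * a₁) : ℂ) + u (k - 1, ℓ) / (Real.sin (ω * a₁) : ℂ)
      + u (k, ℓ + 1) / (Real.sin (ω * a₂) : ℂ) + u (k, ℓ - 1) / (Real.sin (ω * a₂) : ℂ)
      - 2 * (gB a₁ a₂ a₃ β ω : ℂ) * u (k, ℓ) = 0)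
  ∧ u (1, 0) / (Real.sin (ω * a₁) : ℂ) + u (-1, 0) / (Real.sin (ω * a₁) : ℂ)
      + u (0, 1) / (Real.sin (ω * a₂) : ℂ) + u (0, -1) / (Real.sin (ω * a₂) : ℂ)
      - 2 * (gB a₁ a₂ a₃ β ω : ℂ) * u (0, 0)
      = 2 * ((μ - 1 : ℝ) : ℂ) * (phiB a₃ β ω : ℂ) * u (0, 0)

/-- `I_β(ω) = (1/(4π²)) ∫_{(0,2π)²} φ_β(ω)/(φ_β(ω) − f(ξ,η,ω)) dξ dη`. -/
def IB (a₁ a₂ a₃ β ω : ℝ) : ℝ :=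
  (1 / (4 * π ^ 2)) *
    ∫ p in (Ioo (0 : ℝ) (2 * π)) ×ˢ (Ioo (0 : ℝ) (2 * π)),
      phiB a₃ β ω / (phiB a₃ β ω - fFun a₁ a₂ p.1 p.2 ω)

/-- `F_β(ω) = I_β(ω)⁻¹`. -/
def FB (a₁ a₂ a₃ β ω : ℝ) : ℝ := (IB a₁ a₂ a₃ β ω)⁻¹

/-- σ₁ ∪ σ₂ ∪ σ₃ is contained in the dispersion set. -/
theorem stmt0 (a₁ a₂ a₃ β : ℝ) (ha₁ : 0 < a₁) (ha₂ : 0 < a₂) (ha₃ : 0 < a₃)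
    (hβ : β ∈ Icc (0 : ℝ) π) (ω : ℝ) (hω : 0 < ω)
    (h : (∃ n : ℕ, 1 ≤ n ∧ ω = π * n / a₁) ∨ (∃ n : ℕ, 1 ≤ n ∧ ω = π * n / a₂) ∨
      (∃ n : ℤ, ω = (β + 2 * π * n) / a₃) ∨ (∃ n : ℤ, ω = (2 * π * n - β) / a₃)) :
    ω ∈ dispSet a₁ a₂ a₃ β := by
  refine ⟨hω, arccos (cos (ω * a₁)), ⟨arccos_nonneg _, arccos_le_pi _⟩,
    arccos (cos (ω * a₂)), ⟨arccos_nonneg _, arccos_le_pi _⟩, ?_⟩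
  have key : sin (ω * a₁) = 0 ∨ sin (ω * a₂) = 0 ∨ cos (ω * a₃) = cos β := by
    rcases h with ⟨n, -, hn⟩ | ⟨n, -, hn⟩ | ⟨n, hn⟩ | ⟨n, hn⟩
    · left
      rw [hn, div_mul_cancel₀ _ ha₁.ne', mul_comm, sin_nat_mul_pi]
    · right; left
      rw [hn, div_mul_cancel₀ _ ha₂.ne', mul_comm, sin_nat_mul_pi]
    · right; right
      rw [hn, div_mul_cancel₀ _ ha₃.ne', mul_comm, cos_add_int_mul_two_pi]
    · right; right
      rw [hn, div_mul_cancel₀ _ ha₃.ne', mul_comm, cos_int_mul_two_pi_sub]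
  simp only [Dfun, cos_arccos (neg_one_le_cos _) (cos_le_one _), sub_self, mul_zero, zero_add]
  rcases key with h | h | h <;> simp [h]
end
end

section
/- Let a₁, a₂, a₃ > 0 and β ∈ [0, π]. For every M > 0 there exist real numbers ω_b, ω_t with M < ω_b < ω_t such that ω_b ∈ Σ(β), ω_t ∈ Σ(β), and the open interval (ω_b, ω_t) is disjoint from Σ(β). (The dispersion set has infinitely many gaps whose ends tend to infinity.) -/
open Real MeasureTheory Set Filter Topology

noncomputable section

theorem sin_mul_eq_of_sin_eq_zero {w a : ℝ} (h : Real.sin (w * a) = 0) (x : ℝ) :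
    Real.sin (x * a) = Real.cos (w * a) * Real.sin ((x - w) * a) := by
  have hx : x * a = w * a + (x - w) * a := by ring
  rw [hx, Real.sin_add, h]
  ring

theorem cos_mul_eq_of_sin_eq_zero {w a : ℝ} (h : Real.sin (w * a) = 0) (x : ℝ) :
    Real.cos (x * a) = Real.cos (w * a) * Real.cos ((x - w) * a) := by
  have hx : x * a = w * a + (x - w) * a := by ring
  rw [hx, Real.cos_add, h]
  ring

theorem eventually_nhdsGT_sub_mul_mem_Ioo {a : ℝ} (ha : 0 < a) (w : ℝ) {r : ℝ} (hr : 0 < r) :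
    ∀ᶠ x in 𝓝[>] w, (x - w) * a ∈ Ioo 0 r := by
  have h : Tendsto (fun x : ℝ => (x - w) * a) (𝓝[>] w) (𝓝 0) := by
    have : Continuous fun x : ℝ => (x - w) * a := by fun_prop
    simpa using (this.tendsto w).mono_left nhdsWithin_le_nhds
  filter_upwards [h.eventually (gt_mem_nhds hr), self_mem_nhdsWithin] with x hx hxw
  exact ⟨mul_pos (sub_pos.2 hxw) ha, hx⟩

/-- To the right of any point the quotient `(cos k - cos (x a)) / sin (x a)` is bounded above,
uniformly in `k`, even when the point is a zero of the denominator. -/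
theorem exists_eventually_nhdsGT_cos_sub_div_sin_le {a : ℝ} (ha : 0 < a) (w : ℝ) :
    ∃ C : ℝ, ∀ᶠ x in 𝓝[>] w, Real.sin (x * a) ≠ 0 ∧
      ∀ k : ℝ, (Real.cos k - Real.cos (x * a)) / Real.sin (x * a) ≤ C := by
  by_cases h : Real.sin (w * a) = 0
  · refine ⟨1, ?_⟩
    filter_upwards [eventually_nhdsGT_sub_mul_mem_Ioo ha w (half_pos Real.pi_pos)] with x hx
    have hc : Real.cos (w * a) = 1 ∨ Real.cos (w * a) = -1 :=
      Real.sin_eq_zero_iff_cos_eq.1 h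
    rw [sin_mul_eq_of_sin_eq_zero h x, cos_mul_eq_of_sin_eq_zero h x]
    set t := (x - w) * a
    have hs : 0 < Real.sin t := Real.sin_pos_of_pos_of_lt_pi hx.1 (by linarith [hx.2, Real.pi_pos])
    have hct : 0 < Real.cos t := Real.cos_pos_of_mem_Ioo ⟨by linarith [hx.1, Real.pi_pos], hx.2⟩
    have hst : 1 ≤ Real.sin t + Real.cos t := by
      nlinarith [Real.sin_sq_add_cos_sq t, mul_pos hs hct]
    rcases hc with hc | hc <;> rw [hc]
    · refine ⟨by simpa using hs.ne', fun k => ?_⟩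
      rw [one_mul, one_mul, div_le_one hs]
      linarith [Real.cos_le_one k]
    · refine ⟨by simpa using hs.ne', fun k => ?_⟩
      rw [neg_one_mul, neg_one_mul, div_neg, ← neg_div, div_le_one hs]
      linarith [Real.neg_one_le_cos k]
  · have hcont : Continuous fun x : ℝ => |Real.sin (x * a)| := by fun_prop
    have hpos : 0 < |Real.sin (w * a)| := abs_pos.2 h
    refine ⟨2 / (|Real.sin (w * a)| / 2), ?_⟩
    have hev : ∀ᶠ x in 𝓝[>] w, |Real.sin (w * a)| / 2 < |Real.sin (x * a)| :=
      ((hcont.tendsto w).mono_left nhdsWithin_le_nhds).eventually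
        (lt_mem_nhds (half_lt_self hpos))
    filter_upwards [hev] with x hx
    refine ⟨abs_pos.1 ((half_pos hpos).trans hx), fun k => (le_abs_self _).trans ?_⟩
    rw [abs_div]
    refine div_le_div₀ zero_le_two ?_ (half_pos hpos) hx.le
    rw [abs_le]
    constructor <;> linarith [Real.cos_le_one k, Real.neg_one_le_cos k,
      Real.cos_le_one (x * a), Real.neg_one_le_cos (x * a)]

theorem tendsto_phiB_nhdsGT_atTop {a β w : ℝ} (ha : 0 < a) (h : Real.sin (w * a) = 0)
    (hβ : 0 < Real.cos (w * a) * (Real.cos (w * a) - Real.cos β)) :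
    Tendsto (phiB a β) (𝓝[>] w) atTop := by
  have hc : Real.cos (w * a) * Real.cos (w * a) = 1 := by
    nlinarith [Real.sin_sq_add_cos_sq (w * a)]
  have hnum : Tendsto (fun x : ℝ => Real.cos (w * a) * (Real.cos (x * a) - Real.cos β))
      (𝓝[>] w) (𝓝 (Real.cos (w * a) * (Real.cos (w * a) - Real.cos β))) := by
    have : Continuous fun x : ℝ => Real.cos (w * a) * (Real.cos (x * a) - Real.cos β) := by
      fun_prop
    exact (this.tendsto w).mono_left nhdsWithin_le_nhds
  have hden : Tendsto (fun x : ℝ => Real.sin ((x - w) * a)) (𝓝[>] w) (𝓝[>] 0) := by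
    refine tendsto_nhdsWithin_iff.2 ⟨?_, ?_⟩
    · have : Continuous fun x : ℝ => Real.sin ((x - w) * a) := by fun_prop
      simpa using (this.tendsto w).mono_left nhdsWithin_le_nhds
    · filter_upwards [eventually_nhdsGT_sub_mul_mem_Ioo ha w Real.pi_pos] with x hx
      exact Real.sin_pos_of_pos_of_lt_pi hx.1 hx.2
  refine (hnum.pos_mul_atTop hβ (tendsto_inv_nhdsGT_zero.comp hden)).congr fun x => ?_
  have hc0 : Real.cos (w * a) ≠ 0 := left_ne_zero_of_mul hβ.ne'
  rw [phiB, sin_mul_eq_of_sin_eq_zero h, ← mul_div_mul_left _ _ hc0, ← mul_assoc, hc, one_mul,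
    div_eq_mul_inv]
  rfl

theorem Dfun_eq_mul_phiB_sub {a₁ a₂ a₃ β ω : ℝ} (h₁ : Real.sin (ω * a₁) ≠ 0)
    (h₂ : Real.sin (ω * a₂) ≠ 0) (h₃ : Real.sin (ω * a₃) ≠ 0) (k₁ k₂ : ℝ) :
    Dfun a₁ a₂ a₃ β ω k₁ k₂ = Real.sin (ω * a₁) * Real.sin (ω * a₂) * Real.sin (ω * a₃) *
      (phiB a₃ β ω - fFun a₁ a₂ k₁ k₂ ω) := by
  unfold Dfun phiB fFun
  field_simp
  ring

theorem eventually_nhdsGT_notMem_dispSet {a₁ a₂ a₃ β w : ℝ} (ha₁ : 0 < a₁) (ha₂ : 0 < a₂)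
    (ha₃ : 0 < a₃) (h : Real.sin (w * a₃) = 0)
    (hβ : 0 < Real.cos (w * a₃) * (Real.cos (w * a₃) - Real.cos β)) :
    ∀ᶠ ω in 𝓝[>] w, ω ∉ dispSet a₁ a₂ a₃ β := by
  obtain ⟨C₁, hC₁⟩ := exists_eventually_nhdsGT_cos_sub_div_sin_le ha₁ w
  obtain ⟨C₂, hC₂⟩ := exists_eventually_nhdsGT_cos_sub_div_sin_le ha₂ w
  obtain ⟨C₃, hC₃⟩ := exists_eventually_nhdsGT_cos_sub_div_sin_le ha₃ w
  filter_upwards [hC₁, hC₂, hC₃,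
    (tendsto_phiB_nhdsGT_atTop ha₃ h hβ).eventually_gt_atTop (C₁ + C₂)] with ω h₁ h₂ h₃ hφ
  rintro ⟨-, k₁, -, k₂, -, hD⟩
  rw [Dfun_eq_mul_phiB_sub h₁.1 h₂.1 h₃.1] at hD
  refine mul_ne_zero (mul_ne_zero (mul_ne_zero h₁.1 h₂.1) h₃.1) (sub_ne_zero.2 ?_) hD
  exact (lt_of_le_of_lt (add_le_add (h₁.2 k₁) (h₂.2 k₂)) hφ).ne'

theorem mem_dispSet_of_sin_eq_zero {a₁ a₂ a₃ β ω : ℝ} (hω : 0 < ω)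
    (h : Real.sin (ω * a₁) = 0) : ω ∈ dispSet a₁ a₂ a₃ β := by
  refine ⟨hω, Real.arccos (Real.cos (ω * a₁)), ⟨Real.arccos_nonneg _, Real.arccos_le_pi _⟩,
    0, ⟨le_rfl, Real.pi_pos.le⟩, ?_⟩
  rw [Dfun, Real.cos_arccos (Real.neg_one_le_cos _) (Real.cos_le_one _), h]
  ring

theorem isClosed_setOf_exists_Dfun_eq_zero (a₁ a₂ a₃ β : ℝ) :
    IsClosed {ω : ℝ | ∃ k₁ ∈ Icc (0 : ℝ) π, ∃ k₂ ∈ Icc (0 : ℝ) π,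
      Dfun a₁ a₂ a₃ β ω k₁ k₂ = 0} := by
  have hcl : IsClosed {p : ℝ × (Icc (0 : ℝ) π × Icc (0 : ℝ) π) |
      Dfun a₁ a₂ a₃ β p.1 p.2.1 p.2.2 = 0} := by
    refine isClosed_eq ?_ continuous_const
    unfold Dfun
    fun_prop
  convert isClosedMap_fst_of_compactSpace _ hcl using 1
  ext ω
  constructor
  · rintro ⟨k₁, hk₁, k₂, hk₂, hD⟩
    exact ⟨⟨ω, ⟨k₁, hk₁⟩, ⟨k₂, hk₂⟩⟩, hD, rfl⟩
  · rintro ⟨⟨_, k₁, k₂⟩, hD, rfl⟩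
    exact ⟨k₁, k₁.2, k₂, k₂.2, hD⟩

theorem exists_gt_sin_mul_eq_zero {a : ℝ} (ha : 0 < a) (M : ℝ) :
    ∃ ω > M, Real.sin (ω * a) = 0 := by
  obtain ⟨n, hn⟩ := exists_nat_gt (M * a / π)
  refine ⟨n * π / a, ?_, ?_⟩
  · rw [div_lt_iff₀ Real.pi_pos] at hn
    exact (lt_div_iff₀ ha).2 hn
  · rw [div_mul_cancel₀ _ ha.ne', Real.sin_nat_mul_pi]

theorem exists_gt_sin_mul_eq_zero_and_pos {a : ℝ} (ha : 0 < a) (β M : ℝ) :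
    ∃ ω > M, Real.sin (ω * a) = 0 ∧
      0 < Real.cos (ω * a) * (Real.cos (ω * a) - Real.cos β) := by
  obtain ⟨n, hn⟩ := exists_nat_gt (M * a / (2 * π))
  rw [div_lt_iff₀ Real.two_pi_pos] at hn
  rcases (Real.cos_le_one β).lt_or_eq with hβ | hβ
  · refine ⟨n * (2 * π) / a, (lt_div_iff₀ ha).2 hn, ?_⟩
    have hc : Real.cos (n * (2 * π) / a * a) = 1 := by
      rw [div_mul_cancel₀ _ ha.ne', Real.cos_nat_mul_two_pi]
    refine ⟨Real.sin_eq_zero_iff_cos_eq.2 (Or.inl hc), ?_⟩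
    rw [hc]
    linarith
  · refine ⟨(n * (2 * π) + π) / a, (lt_div_iff₀ ha).2 (by linarith [Real.pi_pos]), ?_⟩
    have hc : Real.cos ((n * (2 * π) + π) / a * a) = -1 := by
      rw [div_mul_cancel₀ _ ha.ne', Real.cos_nat_mul_two_pi_add_pi]
    refine ⟨Real.sin_eq_zero_iff_cos_eq.2 (Or.inr hc), ?_⟩
    rw [hc, hβ]
    norm_num

/-- A point outside a closed set and between two of its points lies in a gap of the set. -/
theorem exists_gap_of_notMem {K : Set ℝ} (hK : IsClosed K) {l x u : ℝ} (hl : l ∈ K) (hx : x ∉ K)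
    (hu : u ∈ K) (hlx : l ≤ x) (hxu : x ≤ u) :
    ∃ b t : ℝ, l ≤ b ∧ b < t ∧ b ∈ K ∧ t ∈ K ∧ Ioo b t ∩ K = ∅ := by
  obtain ⟨b, hb, hb_max⟩ := (isCompact_Icc.inter_left hK).exists_isGreatest
    (⟨l, hl, le_rfl, hlx⟩ : (K ∩ Icc l x).Nonempty)
  obtain ⟨t, ht, ht_min⟩ := (isCompact_Icc.inter_left hK).exists_isLeast
    (⟨u, hu, hxu, le_rfl⟩ : (K ∩ Icc x u).Nonempty)
  have hbx : b < x := hb.2.2.lt_of_ne (by rintro rfl; exact hx hb.1)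
  refine ⟨b, t, hb.2.1, hbx.trans_le ht.2.1, hb.1, ht.1, ?_⟩
  refine eq_empty_of_forall_notMem fun y hy => ?_
  rcases le_total y x with hyx | hxy
  · exact hy.1.1.not_ge (hb_max ⟨hy.2, hb.2.1.trans hy.1.1.le, hyx⟩)
  · exact hy.1.2.not_ge (ht_min ⟨hy.2, hxy, hy.1.2.le.trans ht.2.2⟩)

/-- the dispersion set has infinitely many gaps whose ends tend to infinity. -/
theorem stmt1 (a₁ a₂ a₃ β : ℝ) (ha₁ : 0 < a₁) (ha₂ : 0 < a₂) (ha₃ : 0 < a₃)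
    (hβ : β ∈ Icc (0 : ℝ) π) :
    ∀ M > (0 : ℝ), ∃ ωb ωt : ℝ, M < ωb ∧ ωb < ωt ∧
      ωb ∈ dispSet a₁ a₂ a₃ β ∧ ωt ∈ dispSet a₁ a₂ a₃ β ∧
      Ioo ωb ωt ∩ dispSet a₁ a₂ a₃ β = ∅ := by
  intro M hM
  obtain ⟨l, hMl, hl⟩ := exists_gt_sin_mul_eq_zero ha₁ M
  obtain ⟨w, hlw, hw, hwβ⟩ := exists_gt_sin_mul_eq_zero_and_pos ha₃ β l
  obtain ⟨x, hx, hwx⟩ := ((eventually_nhdsGT_notMem_dispSet ha₁ ha₂ ha₃ hw hwβ).and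
    self_mem_nhdsWithin).exists
  obtain ⟨u, hxu, hu⟩ := exists_gt_sin_mul_eq_zero ha₁ x
  have hl0 : 0 < l := hM.trans hMl
  have hlx : l < x := lt_trans hlw hwx
  obtain ⟨b, t, hlb, hbt, hb, ht, hgap⟩ := exists_gap_of_notMem
    (isClosed_setOf_exists_Dfun_eq_zero a₁ a₂ a₃ β) (mem_dispSet_of_sin_eq_zero hl0 hl).2
    (fun h => hx ⟨hl0.trans hlx, h⟩)
    (mem_dispSet_of_sin_eq_zero ((hl0.trans hlx).trans hxu) hu).2 hlx.le hxu.le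
  have hb0 : 0 < b := hl0.trans_le hlb
  refine ⟨b, t, hMl.trans_le hlb, hbt, ⟨hb0, hb⟩, ⟨hb0.trans hbt, ht⟩, ?_⟩
  exact subset_empty_iff.1 (hgap ▸ inter_subset_inter_right _ fun _ h => h.2)
end
end

section
/- Let a₁, a₂, a₃ > 0, β ∈ [0, π], μ > 0, and let ω > 0 satisfy sin(ω aᵢ) ≠ 0 for i = 1, 2, 3. Suppose u : ℤ² → ℂ is absolutely summable (∑_{(k,ℓ)∈ℤ²} |u(k, ℓ)| < ∞) and satisfies the system (FD). Then for every (ξ, η) ∈ ℝ², (f(ξ, η, ω) − φ_β(ω)) · (∑_{(k,ℓ)∈ℤ²} u(k, ℓ) e^{i(kξ + ℓη)}) = (μ − 1) φ_β(ω) u(0, 0). -/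
open Real MeasureTheory Set Filter Topology

noncomputable section

/-- The Fourier character `(k, ℓ) ↦ e^{i(kξ + ℓη)}` on `ℤ²`. -/
def latticeChar (ξ η : ℝ) (p : ℤ × ℤ) : ℂ :=
  Complex.exp (Complex.I * (((p.1 : ℝ) * ξ + (p.2 : ℝ) * η : ℝ) : ℂ))

lemma latticeChar_add (ξ η : ℝ) (p v : ℤ × ℤ) :
    latticeChar ξ η (p + v) = latticeChar ξ η p * latticeChar ξ η v := by
  simp only [latticeChar, ← Complex.exp_add]
  congr 1
  push_cast [Prod.fst_add, Prod.snd_add]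
  ring

lemma norm_latticeChar (ξ η : ℝ) (p : ℤ × ℤ) : ‖latticeChar ξ η p‖ = 1 := by
  rw [latticeChar, mul_comm, Complex.norm_exp_ofReal_mul_I]

lemma latticeChar_add_latticeChar_fst (ξ η : ℝ) :
    latticeChar ξ η (-1, 0) + latticeChar ξ η (1, 0) = 2 * (Real.cos ξ : ℂ) := by
  rw [Complex.ofReal_cos, Complex.two_cos]
  simp [latticeChar, mul_comm, add_comm]

lemma latticeChar_add_latticeChar_snd (ξ η : ℝ) :
    latticeChar ξ η (0, -1) + latticeChar ξ η (0, 1) = 2 * (Real.cos η : ℂ) := by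
  rw [Complex.ofReal_cos, Complex.two_cos]
  simp [latticeChar, mul_comm, add_comm]

lemma summable_mul_latticeChar {u : ℤ × ℤ → ℂ} (hu : Summable fun p => ‖u p‖) (ξ η : ℝ) :
    Summable fun p => u p * latticeChar ξ η p :=
  Summable.of_norm (by simpa [norm_latticeChar] using hu)

lemma hasSum_shift_mul_latticeChar {u : ℤ × ℤ → ℂ} (hu : Summable fun p => ‖u p‖) (ξ η : ℝ)
    (v : ℤ × ℤ) :
    HasSum (fun p => u (p + v) * latticeChar ξ η p)
      ((∑' p, u p * latticeChar ξ η p) * latticeChar ξ η (-v)) := by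
  have h := ((Equiv.addRight v).hasSum_iff.mpr
    (summable_mul_latticeChar hu ξ η).hasSum).mul_right (latticeChar ξ η (-v))
  refine h.congr_fun ?_
  intro p
  simp only [Function.comp_apply, Equiv.coe_addRight]
  rw [mul_assoc, ← latticeChar_add, add_neg_cancel_right]

/-- the discrete Fourier transform of a solution of (FD) satisfies
`(f − φ_β) û = (μ − 1) φ_β u₀₀`. -/
theorem stmt4 (a₁ a₂ a₃ β μ : ℝ) (ha₁ : 0 < a₁) (ha₂ : 0 < a₂) (ha₃ : 0 < a₃)
    (hβ : β ∈ Icc (0 : ℝ) π) (hμ : 0 < μ) (ω : ℝ) (hω : 0 < ω)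
    (hs1 : Real.sin (ω * a₁) ≠ 0) (hs2 : Real.sin (ω * a₂) ≠ 0)
    (hs3 : Real.sin (ω * a₃) ≠ 0) (u : ℤ × ℤ → ℂ)
    (hsum : Summable fun p : ℤ × ℤ => ‖u p‖)
    (hFD : SatisfiesFD a₁ a₂ a₃ β μ ω u) (ξ η : ℝ) :
    ((fFun a₁ a₂ ξ η ω - phiB a₃ β ω : ℝ) : ℂ) *
        (∑' p : ℤ × ℤ, u p *
          Complex.exp (Complex.I * (((p.1 : ℝ) * ξ + (p.2 : ℝ) * η : ℝ) : ℂ)))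
      = ((μ - 1 : ℝ) : ℂ) * (phiB a₃ β ω : ℂ) * u (0, 0) := by
  obtain ⟨hne, h00⟩ := hFD
  change _ * (∑' p : ℤ × ℤ, u p * latticeChar ξ η p) = _
  set U := ∑' p : ℤ × ℤ, u p * latticeChar ξ η p with hU
  have hx := latticeChar_add_latticeChar_fst ξ η
  have hy := latticeChar_add_latticeChar_snd ξ η
  have H := (((((hasSum_shift_mul_latticeChar hsum ξ η (1, 0)).div_const
      (Real.sin (ω * a₁) : ℂ)).add
    ((hasSum_shift_mul_latticeChar hsum ξ η (-1, 0)).div_const (Real.sin (ω * a₁) : ℂ))).add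
    ((hasSum_shift_mul_latticeChar hsum ξ η (0, 1)).div_const (Real.sin (ω * a₂) : ℂ))).add
    ((hasSum_shift_mul_latticeChar hsum ξ η (0, -1)).div_const (Real.sin (ω * a₂) : ℂ))).sub
    ((summable_mul_latticeChar hsum ξ η).hasSum.mul_left (2 * (gB a₁ a₂ a₃ β ω : ℂ)))
  have H' := hasSum_single (f := fun p : ℤ × ℤ =>
      u (p + (1, 0)) * latticeChar ξ η p / (Real.sin (ω * a₁) : ℂ)
      + u (p + (-1, 0)) * latticeChar ξ η p / (Real.sin (ω * a₁) : ℂ)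
      + u (p + (0, 1)) * latticeChar ξ η p / (Real.sin (ω * a₂) : ℂ)
      + u (p + (0, -1)) * latticeChar ξ η p / (Real.sin (ω * a₂) : ℂ)
      - 2 * (gB a₁ a₂ a₃ β ω : ℂ) * (u p * latticeChar ξ η p)) (0, 0) (by
    rintro ⟨k, l⟩ hp
    have h := hne k l hp
    simp only [Prod.mk_add_mk, add_zero, ← sub_eq_add_neg]
    linear_combination latticeChar ξ η (k, l) * h)
  have key := H.unique H'
  have h0 : latticeChar ξ η (0, 0) = 1 := by simp [latticeChar]
  simp only [Prod.mk_add_mk, add_zero, zero_add, Prod.neg_mk, neg_neg, neg_zero, h0, mul_one,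
    ← hU] at key
  have hf : ((fFun a₁ a₂ ξ η ω - phiB a₃ β ω : ℝ) : ℂ)
      = (Real.cos ξ : ℂ) / (Real.sin (ω * a₁) : ℂ) + (Real.cos η : ℂ) / (Real.sin (ω * a₂) : ℂ)
        - (gB a₁ a₂ a₃ β ω : ℂ) := by
    simp only [fFun, gB]
    push_cast
    ring
  rw [hf]
  linear_combination (1 / 2) * key + (1 / 2) * h00
    - U / (2 * (Real.sin (ω * a₁) : ℂ)) * hx - U / (2 * (Real.sin (ω * a₂) : ℂ)) * hy
end
end

section
/- Let a₁, a₂, a₃ > 0, β ∈ [0, π], μ > 0, and let ω > 0 satisfy sin(ω aᵢ) ≠ 0 for i = 1, 2, 3. Assume φ_β(ω) − f(ξ, η, ω) ≠ 0 for all (ξ, η) ∈ [0, 2π]². If u : ℤ² → ℂ is square-summable (∑_{(k,ℓ)∈ℤ²} |u(k, ℓ)|² < ∞) and satisfies the system (FD), then for every (k, ℓ) ∈ ℤ², u(k, ℓ) = ((1 − μ) u(0, 0)/(4π²)) ∫_{(0,2π)²} [φ_β(ω)/(φ_β(ω) − f(ξ, η, ω))] e^{−i(kξ + ℓη)} dξ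 dη. -/
open Real MeasureTheory Set Filter Topology

noncomputable section

/-- The character `(ξ, η) ↦ e^{-i(kξ + ℓη)}` indexed by `n = (k, ℓ)`. -/
def planeChar (n : ℤ × ℤ) (p : ℝ × ℝ) : ℂ :=
  Complex.exp (-Complex.I * (((n.1 : ℝ) * p.1 + (n.2 : ℝ) * p.2 : ℝ) : ℂ))

/-- The open square `(0, 2π)²`. -/
def openSquare : Set (ℝ × ℝ) := Ioo (0 : ℝ) (2 * π) ×ˢ Ioo (0 : ℝ) (2 * π)

/-- The symmetric five-point difference operator with coefficients `a`, `b`, `c`. -/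
def fivePoint (a b c : ℂ) (w : ℤ × ℤ → ℂ) (n : ℤ × ℤ) : ℂ :=
  w (n + (1, 0)) * a + w (n - (1, 0)) * a + w (n + (0, 1)) * b + w (n - (0, 1)) * b - c * w n

theorem norm_planeChar (n : ℤ × ℤ) (p : ℝ × ℝ) : ‖planeChar n p‖ = 1 := by
  have : planeChar n p
      = Complex.exp (((-((n.1 : ℝ) * p.1 + (n.2 : ℝ) * p.2) : ℝ) : ℂ) * Complex.I) := by
    unfold planeChar
    congr 1
    push_cast
    ring
  rw [this, Complex.norm_exp_ofReal_mul_I]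

theorem continuous_planeChar (n : ℤ × ℤ) : Continuous (planeChar n) := by
  unfold planeChar
  fun_prop

theorem planeChar_add (m n : ℤ × ℤ) (p : ℝ × ℝ) :
    planeChar (m + n) p = planeChar m p * planeChar n p := by
  simp only [planeChar, ← Complex.exp_add, Prod.fst_add, Prod.snd_add]
  congr 1
  push_cast
  ring

theorem planeChar_sub (m n : ℤ × ℤ) (p : ℝ × ℝ) :
    planeChar (m - n) p = planeChar m p * planeChar (-n) p := by
  rw [sub_eq_add_neg, planeChar_add]

theorem conj_planeChar (n : ℤ × ℤ) (p : ℝ × ℝ) :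
    (starRingEnd ℂ) (planeChar n p) = planeChar (-n) p := by
  simp only [planeChar, ← Complex.exp_conj]
  congr 1
  simp
  ring

theorem measurableSet_openSquare : MeasurableSet openSquare :=
  measurableSet_Ioo.prod measurableSet_Ioo

instance : IsFiniteMeasure (volume.restrict openSquare) := by
  refine ⟨?_⟩
  rw [Measure.restrict_apply_univ, openSquare, Measure.volume_eq_prod, Measure.prod_prod]
  simp [ENNReal.mul_lt_top]

theorem integral_exp_int_mul (k : ℤ) :
    ∫ x in Ioo (0 : ℝ) (2 * π), Complex.exp (-Complex.I * (k * x))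
      = if k = 0 then ((2 * π : ℝ) : ℂ) else 0 := by
  rw [← integral_Ioc_eq_integral_Ioo, ← intervalIntegral.integral_of_le (by positivity)]
  split_ifs with h
  · simp [h]
  · have hk : -Complex.I * (k : ℂ) ≠ 0 := by simp [h]
    simp_rw [← mul_assoc]
    rw [integral_exp_mul_complex hk]
    have : -Complex.I * (k : ℂ) * ((2 * π : ℝ) : ℂ) = ((-k : ℤ) : ℂ) * (2 * π * Complex.I) := by
      push_cast
      ring
    rw [this, Complex.exp_int_mul_two_pi_mul_I]
    simp

theorem integral_planeChar (n : ℤ × ℤ) :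
    ∫ p in openSquare, planeChar n p = if n = 0 then ((4 * π ^ 2 : ℝ) : ℂ) else 0 := by
  have h : ∀ p : ℝ × ℝ, planeChar n p
      = Complex.exp (-Complex.I * (n.1 * p.1)) * Complex.exp (-Complex.I * (n.2 * p.2)) := by
    intro p
    simp only [planeChar, ← Complex.exp_add]
    congr 1
    push_cast
    ring
  simp_rw [h]
  rw [openSquare, Measure.volume_eq_prod, setIntegral_prod_mul
    (fun x : ℝ => Complex.exp (-Complex.I * (n.1 * x)))
    (fun x : ℝ => Complex.exp (-Complex.I * (n.2 * x))),
    integral_exp_int_mul, integral_exp_int_mul]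
  rcases n with ⟨k, l⟩
  by_cases hk : k = 0 <;> by_cases hl : l = 0 <;> simp [hk, hl]
  ring

theorem memLp_planeChar (n : ℤ × ℤ) : MemLp (planeChar n) 2 (volume.restrict openSquare) :=
  MemLp.of_bound (continuous_planeChar n).aestronglyMeasurable 1
    (ae_of_all _ fun p => (norm_planeChar n p).le)

theorem orthonormal_planeChar :
    Orthonormal ℂ fun n : ℤ × ℤ =>
      ((2 * π : ℝ) : ℂ)⁻¹ • (memLp_planeChar n).toLp (planeChar n) := by
  rw [orthonormal_iff_ite]
  intro m n
  rw [inner_smul_left, inner_smul_right, L2.inner_def]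
  have : ∫ p in openSquare, inner ℂ ((memLp_planeChar m).toLp (planeChar m) p)
      ((memLp_planeChar n).toLp (planeChar n) p) = ∫ p in openSquare, planeChar (n - m) p := by
    refine integral_congr_ae ?_
    filter_upwards [(memLp_planeChar m).coeFn_toLp, (memLp_planeChar n).coeFn_toLp] with p h1 h2
    rw [h1, h2, RCLike.inner_apply, conj_planeChar, planeChar_sub]
  rw [this, integral_planeChar]
  simp only [sub_eq_zero, @eq_comm _ n m]
  have hπ : (π : ℂ) ≠ 0 := by simp [pi_ne_zero]
  split_ifs
  · rw [Complex.conj_inv, Complex.conj_ofReal]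
    push_cast
    field_simp
    norm_num
  · simp

theorem summable_sq_norm_integral_mul_planeChar {h : ℝ × ℝ → ℂ}
    (hh : MemLp h 2 (volume.restrict openSquare)) :
    Summable fun n : ℤ × ℤ => ‖∫ p in openSquare, h p * planeChar n p‖ ^ 2 := by
  have key := (orthonormal_planeChar.inner_products_summable (hh.toLp h)).mul_left ((2 * π) ^ 2)
  have key' := (Equiv.neg (ℤ × ℤ)).summable_iff.mpr key
  refine key'.congr fun n => ?_
  simp only [Function.comp_apply, Equiv.neg_apply]
  rw [inner_smul_left, L2.inner_def]
  have : ∫ p in openSquare, inner ℂ ((memLp_planeChar (-n)).toLp (planeChar (-n)) p)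
      (hh.toLp h p) = ∫ p in openSquare, h p * planeChar n p := by
    refine integral_congr_ae ?_
    filter_upwards [(memLp_planeChar (-n)).coeFn_toLp, hh.coeFn_toLp] with p h1 h2
    rw [h1, h2, RCLike.inner_apply, conj_planeChar, neg_neg]
  rw [this, norm_mul, mul_pow]
  have hπ := pi_pos
  simp [abs_of_pos hπ]
  field_simp

theorem summable_mul_of_summable_sq_norm {ι : Type*} {v w : ι → ℂ}
    (hv : Summable fun i => ‖v i‖ ^ 2) (hw : Summable fun i => ‖w i‖ ^ 2) :
    Summable fun i => v i * w i := by
  refine Summable.of_norm_bounded (hv.add hw) fun i => ?_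
  rw [norm_mul]
  nlinarith [sq_nonneg (‖v i‖ - ‖w i‖), sq_nonneg (‖v i‖), sq_nonneg (‖w i‖)]

/-- Moving a five-point difference operator across a convolution of square-summable functions. -/
theorem tsum_fivePoint_mul (a b c : ℂ) {v w : ℤ × ℤ → ℂ}
    (hv : Summable fun p => ‖v p‖ ^ 2) (hw : Summable fun p => ‖w p‖ ^ 2) (n : ℤ × ℤ) :
    ∑' m, fivePoint a b c v m * w (n - m) = ∑' m, v m * fivePoint a b c w (n - m) := by
  have hs : ∀ d : ℤ × ℤ, Summable fun m => v m * w (n - m + d) := fun d => by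
    refine summable_mul_of_summable_sq_norm hv ?_
    have := ((Equiv.subLeft n).trans (Equiv.addRight d)).summable_iff.mpr hw
    exact this.congr fun m => by simp
  have ht : ∀ d : ℤ × ℤ, HasSum (fun m => v (m + d) * w (n - m)) (∑' m, v m * w (n - m + d)) :=
    fun d => by
      have := (Equiv.addRight d).hasSum_iff.mpr (hs d).hasSum
      convert this using 2 with m
      simp [sub_add_eq_sub_sub]
  have h1 := ((((ht (1, 0)).mul_right a).add ((ht (-(1, 0))).mul_right a)).add
    ((ht (0, 1)).mul_right b)).add ((ht (-(0, 1))).mul_right b) |>.sub ((ht 0).mul_left c)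
  have h2 := (((((hs (1, 0)).hasSum.mul_right a).add ((hs (-(1, 0))).hasSum.mul_right a)).add
    ((hs (0, 1)).hasSum.mul_right b)).add ((hs (-(0, 1))).hasSum.mul_right b)).sub
      ((hs 0).hasSum.mul_left c)
  have h3 := h1.tsum_eq.trans h2.tsum_eq.symm
  refine (tsum_congr fun m => ?_).trans (h3.trans (tsum_congr fun m => ?_))
  · simp only [fivePoint, sub_eq_add_neg, add_zero]
    ring
  · simp only [fivePoint, sub_eq_add_neg, add_zero]
    ring

theorem fivePoint_planeChar (s t r : ℝ) (n : ℤ × ℤ) (p : ℝ × ℝ) :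
    fivePoint s t (2 * r) (fun m => planeChar m p) n
      = ((2 * (Real.cos p.1 * s + Real.cos p.2 * t - r) : ℝ) : ℂ) * planeChar n p := by
  simp only [fivePoint, planeChar_add, planeChar_sub]
  have h1 : planeChar (1, 0) p + planeChar (-(1, 0)) p = 2 * Complex.cos p.1 := by
    rw [Complex.two_cos, add_comm]
    simp only [planeChar]
    congr 2 <;> (simp; try ring)
  have h2 : planeChar (0, 1) p + planeChar (-(0, 1)) p = 2 * Complex.cos p.2 := by
    rw [Complex.two_cos, add_comm]
    simp only [planeChar]
    congr 2 <;> (simp; try ring)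
  push_cast
  linear_combination (planeChar n p * s) * h1 + (planeChar n p * t) * h2

theorem fivePoint_integral (a b c : ℂ) {h : ℝ × ℝ → ℂ}
    (hh : MemLp h 2 (volume.restrict openSquare)) (n : ℤ × ℤ) :
    fivePoint a b c (fun m => ∫ p in openSquare, h p * planeChar m p) n
      = ∫ p in openSquare, h p * fivePoint a b c (fun m => planeChar m p) n := by
  have hi : ∀ m, Integrable (fun p => h p * planeChar m p) (volume.restrict openSquare) :=
    fun m => hh.integrable_mul (memLp_planeChar m)
  simp only [fivePoint]
  rw [← integral_mul_const, ← integral_mul_const, ← integral_mul_const, ← integral_mul_const,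
    ← integral_const_mul, ← integral_add, ← integral_add, ← integral_add, ← integral_sub]
  · refine integral_congr_ae (ae_of_all _ fun p => ?_)
    ring
  · exact ((((hi _).mul_const _).add ((hi _).mul_const _)).add ((hi _).mul_const _)).add
      ((hi _).mul_const _)
  · exact (hi _).const_mul _
  · exact (((hi _).mul_const _).add ((hi _).mul_const _)).add ((hi _).mul_const _)
  · exact (hi _).mul_const _
  · exact ((hi _).mul_const _).add ((hi _).mul_const _)
  · exact (hi _).mul_const _
  · exact (hi _).mul_const _
  · exact (hi _).mul_const _

theorem memLp_of_continuousOn {h : ℝ × ℝ → ℂ}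
    (hc : ContinuousOn h (Icc (0 : ℝ) (2 * π) ×ˢ Icc (0 : ℝ) (2 * π))) :
    MemLp h 2 (volume.restrict openSquare) := by
  have hsub : openSquare ⊆ Icc (0 : ℝ) (2 * π) ×ˢ Icc (0 : ℝ) (2 * π) :=
    Set.prod_mono Ioo_subset_Icc_self Ioo_subset_Icc_self
  obtain ⟨M, hM⟩ := (isCompact_Icc.prod isCompact_Icc).exists_bound_of_continuousOn hc
  refine MemLp.of_bound ((hc.mono hsub).aestronglyMeasurable measurableSet_openSquare) M ?_
  exact ae_restrict_of_forall_mem measurableSet_openSquare fun p hp => hM p (hsub hp)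

/-- inversion of the discrete Fourier transform gives the values of
a square-summable solution of (FD). -/
theorem stmt5 (a₁ a₂ a₃ β μ : ℝ) (ha₁ : 0 < a₁) (ha₂ : 0 < a₂) (ha₃ : 0 < a₃)
    (hβ : β ∈ Icc (0 : ℝ) π) (hμ : 0 < μ) (ω : ℝ) (hω : 0 < ω)
    (hs1 : Real.sin (ω * a₁) ≠ 0) (hs2 : Real.sin (ω * a₂) ≠ 0)
    (hs3 : Real.sin (ω * a₃) ≠ 0)
    (hnv : ∀ ξ ∈ Icc (0 : ℝ) (2 * π), ∀ η ∈ Icc (0 : ℝ) (2 * π),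
      phiB a₃ β ω - fFun a₁ a₂ ξ η ω ≠ 0)
    (u : ℤ × ℤ → ℂ) (hsum : Summable fun p : ℤ × ℤ => ‖u p‖ ^ 2)
    (hFD : SatisfiesFD a₁ a₂ a₃ β μ ω u) :
    ∀ k ℓ : ℤ, u (k, ℓ) =
      ((1 - μ : ℝ) : ℂ) * u (0, 0) / ((4 * π ^ 2 : ℝ) : ℂ) *
        ∫ p in (Ioo (0 : ℝ) (2 * π)) ×ˢ (Ioo (0 : ℝ) (2 * π)),
          ((phiB a₃ β ω / (phiB a₃ β ω - fFun a₁ a₂ p.1 p.2 ω) : ℝ) : ℂ) *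
            Complex.exp (-Complex.I * (((k : ℝ) * p.1 + (ℓ : ℝ) * p.2 : ℝ) : ℂ)) := by
  intro k ℓ
  set φ := phiB a₃ β ω with hφ
  set s := (Real.sin (ω * a₁))⁻¹ with hs
  set t := (Real.sin (ω * a₂))⁻¹ with ht
  set r := gB a₁ a₂ a₃ β ω with hr
  have hsymb : ∀ p : ℝ × ℝ,
      Real.cos p.1 * s + Real.cos p.2 * t - r = -(φ - fFun a₁ a₂ p.1 p.2 ω) := by
    intro p
    rw [hr, hs, ht, gB, fFun]
    ring
  set h : ℝ × ℝ → ℂ := fun p => (((φ - fFun a₁ a₂ p.1 p.2 ω)⁻¹ : ℝ) : ℂ) with hh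
  have hcont : ContinuousOn h (Icc (0 : ℝ) (2 * π) ×ˢ Icc (0 : ℝ) (2 * π)) := by
    refine Complex.continuous_ofReal.comp_continuousOn (ContinuousOn.inv₀ ?_ ?_)
    · unfold fFun
      fun_prop
    · exact fun p hp => hnv p.1 hp.1 p.2 hp.2
  have hLp := memLp_of_continuousOn hcont
  set G : ℤ × ℤ → ℂ := fun n => ∫ p in openSquare, h p * planeChar n p with hG
  have hGsum : Summable fun n => ‖G n‖ ^ 2 := summable_sq_norm_integral_mul_planeChar hLp
  have hSG : ∀ n, fivePoint s t (2 * r) G n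
      = if n = 0 then -2 * ((4 * π ^ 2 : ℝ) : ℂ) else 0 := by
    intro n
    rw [hG, fivePoint_integral _ _ _ hLp]
    have : ∫ p in openSquare, h p * fivePoint s t (2 * r) (fun m => planeChar m p) n
        = ∫ p in openSquare, -2 * planeChar n p := by
      refine setIntegral_congr_fun measurableSet_openSquare fun p hp => ?_
      have hne : ((φ - fFun a₁ a₂ p.1 p.2 ω : ℝ) : ℂ) ≠ 0 := by
        exact_mod_cast hnv p.1 (Ioo_subset_Icc_self hp.1) p.2 (Ioo_subset_Icc_self hp.2)
      simp only [fivePoint_planeChar, hsymb, hh]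
      rw [Complex.ofReal_inv, Complex.ofReal_mul, Complex.ofReal_neg, ← mul_assoc]
      congr 1
      field_simp
      norm_num
    rw [this, integral_const_mul, integral_planeChar]
    split_ifs <;> simp
  have hSu : ∀ n, fivePoint s t (2 * r) u n
      = if n = 0 then 2 * ((μ - 1 : ℝ) : ℂ) * (φ : ℂ) * u 0 else 0 := by
    rintro ⟨i, j⟩
    split_ifs with hij
    · obtain ⟨rfl, rfl⟩ := Prod.mk.inj hij
      have := hFD.2
      simp only [fivePoint, hs, ht, Complex.ofReal_inv, ← div_eq_mul_inv]
      rw [← hr, ← hφ] at this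
      simpa [← Prod.mk_zero_zero] using this
    · have := hFD.1 i j hij
      simp only [fivePoint, hs, ht, Complex.ofReal_inv, ← div_eq_mul_inv]
      simpa using this
  have key := tsum_fivePoint_mul (s : ℂ) t (2 * r) hsum hGsum (k, ℓ)
  rw [tsum_eq_single 0 (fun m hm => by rw [hSu, if_neg hm, zero_mul]),
    tsum_eq_single (k, ℓ) (fun m hm => by
      rw [hSG, if_neg (sub_ne_zero.mpr hm.symm), mul_zero]), hSu, hSG] at key
  simp only [if_true, sub_self, sub_zero] at key
  have hint : ∫ p in (Ioo (0 : ℝ) (2 * π)) ×ˢ (Ioo (0 : ℝ) (2 * π)),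
      ((φ / (φ - fFun a₁ a₂ p.1 p.2 ω) : ℝ) : ℂ) *
        Complex.exp (-Complex.I * (((k : ℝ) * p.1 + (ℓ : ℝ) * p.2 : ℝ) : ℂ))
      = φ * G (k, ℓ) := by
    rw [hG, ← integral_const_mul]
    refine integral_congr_ae (ae_of_all _ fun p => ?_)
    simp only [hh, planeChar, div_eq_mul_inv, Complex.ofReal_mul, mul_assoc]
  rw [hint]
  have hπ : ((4 * π ^ 2 : ℝ) : ℂ) ≠ 0 := by
    exact_mod_cast (by positivity : (4 * π ^ 2 : ℝ) ≠ 0)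
  rw [div_mul_eq_mul_div, eq_div_iff hπ]
  change _ = _ * u 0 * _
  push_cast at key ⊢
  linear_combination (1 / 2 : ℂ) * key
end
end

section
/- Let a₁, a₂, a₃ > 0 and β ∈ [0, π]. Let ω > 0 satisfy sin(ω aᵢ) ≠ 0 for i = 1, 2, 3, ω ∉ Σ(β), and φ_β(ω) − f(ξ, η, ω) ≠ 0 for all (ξ, η) ∈ [0, 2π]². Then I_β(ω) ≥ 0 (hence F_β(ω) ≥ 0): the function F_β is nonnegative in any spectral gap. -/
open Real MeasureTheory Set Filter Topology

noncomputable section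

/-- At fixed `ω`, the function `(ξ, η) ↦ f(ξ, η, ω)` vanishes somewhere on `[0, 2π]²`. -/
theorem exists_fFun_eq_zero (a₁ a₂ ω : ℝ) :
    ∃ p ∈ Icc (0 : ℝ) (2 * π) ×ˢ Icc (0 : ℝ) (2 * π), fFun a₁ a₂ p.1 p.2 ω = 0 := by
  have hmem (x : ℝ) : Real.arccos (Real.cos x) ∈ Icc (0 : ℝ) (2 * π) :=
    ⟨Real.arccos_nonneg _, by linarith [Real.arccos_le_pi (Real.cos x), Real.pi_pos]⟩
  have hcos (x : ℝ) : Real.cos (Real.arccos (Real.cos x)) = Real.cos x :=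
    Real.cos_arccos (Real.neg_one_le_cos x) (Real.cos_le_one x)
  exact ⟨(Real.arccos (Real.cos (ω * a₁)), Real.arccos (Real.cos (ω * a₂))),
    ⟨hmem _, hmem _⟩, by simp [fFun, hcos]⟩

theorem continuous_fFun (a₁ a₂ ω : ℝ) :
    Continuous fun p : ℝ × ℝ => fFun a₁ a₂ p.1 p.2 ω := by
  unfold fFun
  fun_prop

/-- If `c - f` has no zero on `[0, 2π]²`, then it has the sign of `c` there. -/
theorem div_sub_fFun_nonneg (a₁ a₂ ω c : ℝ)
    (hnv : ∀ ξ ∈ Icc (0 : ℝ) (2 * π), ∀ η ∈ Icc (0 : ℝ) (2 * π), c - fFun a₁ a₂ ξ η ω ≠ 0)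
    {p : ℝ × ℝ} (hp : p ∈ Icc (0 : ℝ) (2 * π) ×ˢ Icc (0 : ℝ) (2 * π)) :
    0 ≤ c / (c - fFun a₁ a₂ p.1 p.2 ω) := by
  obtain ⟨q, hq, hq0⟩ := exists_fFun_eq_zero a₁ a₂ ω
  rw [div_nonneg_iff, ← mul_nonneg_iff]
  by_contra! hneg
  obtain ⟨r, hr, hr0⟩ := (isPreconnected_Icc.prod isPreconnected_Icc).intermediate_value hp hq
    (f := fun x : ℝ × ℝ => c * (c - fFun a₁ a₂ x.1 x.2 ω))
    (continuous_const.mul (continuous_const.sub (continuous_fFun a₁ a₂ ω))).continuousOn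
    (show (0 : ℝ) ∈ Icc _ _ from ⟨hneg.le, by simpa [hq0] using mul_self_nonneg c⟩)
  rcases mul_eq_zero.mp hr0 with h | h
  · simp [h] at hneg
  · exact hnv r.1 hr.1 r.2 hr.2 h

/-- `I_β(ω) ≥ 0` (hence `F_β(ω) ≥ 0`) in any spectral gap. -/
theorem stmt7 (a₁ a₂ a₃ β : ℝ) (ha₁ : 0 < a₁) (ha₂ : 0 < a₂) (ha₃ : 0 < a₃)
    (hβ : β ∈ Icc (0 : ℝ) π) (ω : ℝ) (hω : 0 < ω)
    (hs1 : Real.sin (ω * a₁) ≠ 0) (hs2 : Real.sin (ω * a₂) ≠ 0)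
    (hs3 : Real.sin (ω * a₃) ≠ 0) (hgap : ω ∉ dispSet a₁ a₂ a₃ β)
    (hnv : ∀ ξ ∈ Icc (0 : ℝ) (2 * π), ∀ η ∈ Icc (0 : ℝ) (2 * π),
      phiB a₃ β ω - fFun a₁ a₂ ξ η ω ≠ 0) :
    0 ≤ IB a₁ a₂ a₃ β ω ∧ 0 ≤ FB a₁ a₂ a₃ β ω := by
  have hI : 0 ≤ IB a₁ a₂ a₃ β ω :=
    mul_nonneg (by positivity) <|
      setIntegral_nonneg (measurableSet_Ioo.prod measurableSet_Ioo) fun _ hp =>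
        div_sub_fFun_nonneg a₁ a₂ ω _ hnv (prod_mono Ioo_subset_Icc_self Ioo_subset_Icc_self hp)
  exact ⟨hI, inv_nonneg.mpr hI⟩
end
end

section
/- Let a₁, a₂, a₃ > 0, β ∈ [0, π] and μ > 1. Let ω > 0 satisfy sin(ω aᵢ) ≠ 0 for i = 1, 2, 3 and ω ∉ Σ(β). Then every square-summable u : ℤ² → ℂ satisfying the system (FD) is identically zero. (For μ > 1 the perturbed operator has no eigenvalue in the gaps.) -/
open Real MeasureTheory Set Filter Topology

noncomputable section

lemma exists_abs_le_one_mul_eq_abs (s : ℝ) : ∃ e : ℝ, |e| ≤ 1 ∧ e * s = |s| := by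
  rcases le_total 0 s with h | h
  · exact ⟨1, by simp, by rw [abs_of_nonneg h, one_mul]⟩
  · exact ⟨-1, by simp, by rw [abs_of_nonpos h]; ring⟩

lemma Dfun_eq {a₁ a₂ a₃ β ω k₁ k₂ : ℝ}
    (hs1 : Real.sin (ω * a₁) ≠ 0) (hs2 : Real.sin (ω * a₂) ≠ 0) (hs3 : Real.sin (ω * a₃) ≠ 0) :
    Dfun a₁ a₂ a₃ β ω k₁ k₂ =
      Real.sin (ω * a₁) * Real.sin (ω * a₂) * Real.sin (ω * a₃) *
        (gB a₁ a₂ a₃ β ω -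
          (Real.cos k₁ * (Real.sin (ω * a₁))⁻¹ + Real.cos k₂ * (Real.sin (ω * a₂))⁻¹)) := by
  unfold Dfun gB phiB
  field_simp
  ring

/-- Outside the dispersion set, `g_β` exceeds half the norm of the hopping part of (FD). -/
lemma lt_abs_gB_of_notMem_dispSet {a₁ a₂ a₃ β ω : ℝ} (hω : 0 < ω)
    (hs1 : Real.sin (ω * a₁) ≠ 0) (hs2 : Real.sin (ω * a₂) ≠ 0)
    (hs3 : Real.sin (ω * a₃) ≠ 0) (hgap : ω ∉ dispSet a₁ a₂ a₃ β) :
    |(Real.sin (ω * a₁))⁻¹| + |(Real.sin (ω * a₂))⁻¹| < |gB a₁ a₂ a₃ β ω| := by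
  by_contra! hle
  set s := (Real.sin (ω * a₁))⁻¹
  set t := (Real.sin (ω * a₂))⁻¹
  have hpos : 0 < |s| + |t| := by
    have : 0 < |s| := abs_pos.mpr (inv_ne_zero hs1)
    positivity
  obtain ⟨e, he, hes⟩ := exists_abs_le_one_mul_eq_abs s
  obtain ⟨d, hd, hdt⟩ := exists_abs_le_one_mul_eq_abs t
  set r := gB a₁ a₂ a₃ β ω / (|s| + |t|) with hr
  have hr1 : |r| ≤ 1 := by
    rw [hr, abs_div, abs_of_pos hpos]
    exact div_le_one_of_le₀ hle hpos.le
  have hcos : ∀ x : ℝ, |x| ≤ 1 → Real.cos (Real.arccos (r * x)) = r * x := fun x hx => by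
    have h : |r * x| ≤ 1 := by
      rw [abs_mul]
      exact mul_le_one₀ hr1 (abs_nonneg x) hx
    exact Real.cos_arccos (abs_le.mp h).1 (abs_le.mp h).2
  refine hgap ⟨hω, Real.arccos (r * e), ⟨Real.arccos_nonneg _, Real.arccos_le_pi _⟩,
    Real.arccos (r * d), ⟨Real.arccos_nonneg _, Real.arccos_le_pi _⟩, ?_⟩
  have hsum : gB a₁ a₂ a₃ β ω = r * e * s + r * d * t := by
    rw [mul_assoc, mul_assoc, hes, hdt, ← mul_add, hr, div_mul_cancel₀ _ hpos.ne']
  rw [Dfun_eq hs1 hs2 hs3, hcos e he, hcos d hd, sub_eq_zero.mpr hsum, mul_zero]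

/-- Outside the dispersion set, `g_β` and `φ_β` have the same sign. -/
lemma gB_mul_phiB_nonneg {a₁ a₂ a₃ β ω : ℝ}
    (h : |(Real.sin (ω * a₁))⁻¹| + |(Real.sin (ω * a₂))⁻¹| < |gB a₁ a₂ a₃ β ω|) :
    0 ≤ gB a₁ a₂ a₃ β ω * phiB a₃ β ω := by
  have hc : ∀ x : ℝ, |Real.cos x / Real.sin x| ≤ |(Real.sin x)⁻¹| := fun x => by
    rw [div_eq_mul_inv, abs_mul]
    exact mul_le_of_le_one_left (abs_nonneg _) (Real.abs_cos_le_one x)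
  set g := gB a₁ a₂ a₃ β ω with hg
  set C := Real.cos (ω * a₁) / Real.sin (ω * a₁) + Real.cos (ω * a₂) / Real.sin (ω * a₂) with hC
  have hφ : phiB a₃ β ω = g - C := by rw [hg, gB, hC]; ring
  have hCg : |C| ≤ |g| :=
    (abs_add_le _ _).trans ((add_le_add (hc _) (hc _)).trans h.le)
  have h1 : g * C ≤ |g| * |C| := (le_abs_self _).trans (abs_mul g C).le
  have h2 : |g| * |C| ≤ |g| * |g| := mul_le_mul_of_nonneg_left hCg (abs_nonneg g)
  rw [abs_mul_abs_self] at h2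
  rw [hφ, mul_sub]
  linarith

/-- The maximum principle for a lattice Schrödinger equation whose potential dominates the
hopping part: bounded solutions vanish. -/
lemma eq_zero_of_bounded_of_hopping {s t G : ℝ} (hG : |s| + |t| < G) {V : ℤ × ℤ → ℝ}
    (hV : ∀ p, G ≤ |V p|) {u : ℤ × ℤ → ℂ} (hb : BddAbove (range fun p => ‖u p‖))
    (hu : ∀ k ℓ : ℤ, (s : ℂ) * (u (k + 1, ℓ) + u (k - 1, ℓ))
      + (t : ℂ) * (u (k, ℓ + 1) + u (k, ℓ - 1)) = 2 * (V (k, ℓ) : ℂ) * u (k, ℓ)) :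
    u = 0 := by
  set M := ⨆ p, ‖u p‖
  have hle : ∀ p, ‖u p‖ ≤ M := le_ciSup hb
  have hM0 : 0 ≤ M := (norm_nonneg _).trans (hle 0)
  have hG0 : 0 < G := lt_of_le_of_lt (by positivity) hG
  have key : ∀ p, ‖u p‖ ≤ (|s| + |t|) * M / G := by
    rintro ⟨k, ℓ⟩
    rw [le_div_iff₀ hG0]
    have hpair : ∀ (c : ℝ) (p q : ℤ × ℤ), ‖(c : ℂ) * (u p + u q)‖ ≤ |c| * (2 * M) :=
      fun c p q => by
        rw [norm_mul, Complex.norm_real, Real.norm_eq_abs]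
        refine mul_le_mul_of_nonneg_left ?_ (abs_nonneg c)
        linarith [norm_add_le (u p) (u q), hle p, hle q]
    have h1 : ‖2 * (V (k, ℓ) : ℂ) * u (k, ℓ)‖ ≤ |s| * (2 * M) + |t| * (2 * M) := by
      rw [← hu k ℓ]
      exact (norm_add_le _ _).trans (add_le_add (hpair _ _ _) (hpair _ _ _))
    rw [norm_mul, norm_mul, Complex.norm_real, Real.norm_eq_abs, Complex.norm_ofNat] at h1
    have h2 := mul_le_mul_of_nonneg_right (hV (k, ℓ)) (norm_nonneg (u (k, ℓ)))
    linarith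
  have hMle : M ≤ (|s| + |t|) * M / G := ciSup_le key
  rw [le_div_iff₀ hG0] at hMle
  have hMz : M = 0 := by
    by_contra hne
    have := mul_lt_mul_of_pos_right hG (lt_of_le_of_ne hM0 (Ne.symm hne))
    linarith
  funext p
  exact norm_le_zero_iff.mp ((hle p).trans hMz.le)

lemma bddAbove_range_norm_of_summable_sq {ι E : Type*} [NormedAddCommGroup E] {u : ι → E}
    (h : Summable fun p => ‖u p‖ ^ 2) : BddAbove (range fun p => ‖u p‖) := by
  refine ⟨Real.sqrt (∑' p, ‖u p‖ ^ 2), ?_⟩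
  rintro _ ⟨p, rfl⟩
  exact Real.le_sqrt_of_sq_le (h.le_tsum p fun q _ => sq_nonneg _)

/-- for `μ > 1` there is no nontrivial square-summable solution of (FD)
at frequencies outside the dispersion set. -/
theorem stmt8 (a₁ a₂ a₃ β μ : ℝ) (ha₁ : 0 < a₁) (ha₂ : 0 < a₂) (ha₃ : 0 < a₃)
    (hβ : β ∈ Icc (0 : ℝ) π) (hμ : 1 < μ) (ω : ℝ) (hω : 0 < ω)
    (hs1 : Real.sin (ω * a₁) ≠ 0) (hs2 : Real.sin (ω * a₂) ≠ 0)
    (hs3 : Real.sin (ω * a₃) ≠ 0) (hgap : ω ∉ dispSet a₁ a₂ a₃ β) :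
    ∀ u : ℤ × ℤ → ℂ, (Summable fun p : ℤ × ℤ => ‖u p‖ ^ 2) →
      SatisfiesFD a₁ a₂ a₃ β μ ω u → u = 0 := by
  intro u hsum hFD
  have hlt := lt_abs_gB_of_notMem_dispSet hω hs1 hs2 hs3 hgap
  have hsign := gB_mul_phiB_nonneg hlt
  refine eq_zero_of_bounded_of_hopping hlt
    (V := fun p => if p = 0 then gB a₁ a₂ a₃ β ω + (μ - 1) * phiB a₃ β ω else gB a₁ a₂ a₃ β ω)
    (fun p => ?_) (bddAbove_range_norm_of_summable_sq hsum) (fun k ℓ => ?_)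
  · split_ifs
    · rw [← sq_le_sq]
      nlinarith [mul_nonneg (sub_pos.mpr hμ).le hsign, sq_nonneg ((μ - 1) * phiB a₃ β ω)]
    · exact le_rfl
  · by_cases h0 : (k, ℓ) = ((0 : ℤ), (0 : ℤ))
    · obtain ⟨rfl, rfl⟩ := Prod.mk.inj h0
      have h := hFD.2
      simp only [Prod.mk_zero_zero, if_true, zero_add, zero_sub] at h ⊢
      push_cast at h ⊢
      linear_combination h
    · have h := hFD.1 k ℓ h0
      rw [if_neg (show (k, ℓ) ≠ 0 from h0), Complex.ofReal_inv, Complex.ofReal_inv]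
      linear_combination h
end
end

section
/- Let a₁, a₂, a₃ > 0 and β ∈ [0, π], and let (ω_b, ω_t) be a gap of Σ(β) of type (i) with distinguished point ω₀ ∈ (ω_b, ω_t) ∩ 𝒲(β). Then F_β(ω) → 1 as ω → ω₀ with ω ∈ (ω_b, ω_t) \ {ω₀}; equivalently, 1 − F_β(ω) → 0 as ω → ω₀ within the gap. -/
open Real MeasureTheory Set Filter Topology

noncomputable section

/-- In a gap, `sin (ω a₁)` and `sin (ω a₂)` do not vanish. -/
lemma sin_ne_zero_of_notMem_dispSet {a₁ a₂ a₃ β ω : ℝ} (hω : 0 < ω)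
    (h : ω ∉ dispSet a₁ a₂ a₃ β) : Real.sin (ω * a₁) ≠ 0 ∧ Real.sin (ω * a₂) ≠ 0 := by
  have key : ∀ x : ℝ, ∃ k ∈ Icc (0 : ℝ) π, Real.cos x - Real.cos k = 0 := fun x =>
    ⟨Real.arccos (Real.cos x), ⟨Real.arccos_nonneg _, Real.arccos_le_pi _⟩, by
      rw [Real.cos_arccos (Real.neg_one_le_cos x) (Real.cos_le_one x), sub_self]⟩
  obtain ⟨k₁, hk₁, e₁⟩ := key (ω * a₁)
  obtain ⟨k₂, hk₂, e₂⟩ := key (ω * a₂)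
  constructor <;> intro hs <;> exact h ⟨hω, k₁, hk₁, k₂, hk₂, by simp [Dfun, hs, e₁, e₂]⟩

/-- At the points of `𝒲(β)` the denominator of `φ_β` vanishes, but its numerator does not. -/
lemma sin_eq_zero_of_mem_Wset {a₃ β ω : ℝ} (ha₃ : 0 < a₃) (hβ : β ∈ Icc (0 : ℝ) π)
    (h : ω ∈ Wset a₃ β) :
    Real.sin (ω * a₃) = 0 ∧ Real.cos (ω * a₃) - Real.cos β ≠ 0 := by
  unfold Wset at h
  split_ifs at h with hc
  · obtain ⟨n, -, rfl⟩ := h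
    have e : (β / a₃ + (2 * n + 1) * π / a₃) * a₃ = β + π + n * (2 * π) := by
      field_simp
      ring
    rw [e, Real.sin_add_nat_mul_two_pi, Real.cos_add_nat_mul_two_pi, Real.sin_add_pi,
      Real.cos_add_pi]
    rcases hc with rfl | rfl <;> norm_num
  · obtain ⟨n, -, rfl⟩ := h
    have e : π * n / a₃ * a₃ = n * π := by
      field_simp
    push Not at hc
    have hs : Real.sin β ≠ 0 :=
      (Real.sin_pos_of_pos_of_lt_pi (lt_of_le_of_ne hβ.1 (Ne.symm hc.1))
        (lt_of_le_of_ne hβ.2 hc.2)).ne'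
    rw [e, Real.sin_nat_mul_pi]
    refine ⟨rfl, fun h0 => hs ?_⟩
    have h1 := Real.sin_sq_add_cos_sq (n * π)
    rw [Real.sin_nat_mul_pi, sub_eq_zero.mp h0] at h1
    have h2 := Real.sin_sq_add_cos_sq β
    exact pow_eq_zero_iff two_ne_zero |>.mp (by linarith)

lemma abs_fFun_le (a₁ a₂ ξ η ω : ℝ) :
    |fFun a₁ a₂ ξ η ω| ≤ 2 / |Real.sin (ω * a₁)| + 2 / |Real.sin (ω * a₂)| := by
  have key : ∀ x y : ℝ, |Real.cos x - Real.cos y| ≤ 2 := fun x y => by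
    rw [abs_le]
    constructor <;> linarith [Real.neg_one_le_cos x, Real.neg_one_le_cos y,
      Real.cos_le_one x, Real.cos_le_one y]
  refine (abs_add_le _ _).trans ?_
  rw [abs_div, abs_div]
  gcongr <;> exact key _ _

lemma measurable_integrand (a₁ a₂ c ω : ℝ) :
    Measurable fun p : ℝ × ℝ => c / (c - fFun a₁ a₂ p.1 p.2 ω) := by
  unfold fFun
  fun_prop

/-- `φ_β` blows up at a zero of `sin (ω a₃)` where the numerator does not vanish. -/
lemma tendsto_inv_phiB {a₃ β ω₀ : ℝ} (hs : Real.sin (ω₀ * a₃) = 0)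
    (hn : Real.cos (ω₀ * a₃) - Real.cos β ≠ 0) :
    Tendsto (fun ω => (phiB a₃ β ω)⁻¹) (𝓝 ω₀) (𝓝 0) := by
  have h : ContinuousAt
      (fun ω => Real.sin (ω * a₃) / (Real.cos (ω * a₃) - Real.cos β)) ω₀ :=
    ContinuousAt.div (by fun_prop) (by fun_prop) hn
  have h' := h.tendsto
  simp only [hs, zero_div] at h'
  simpa only [phiB, inv_div] using h'

/-- `φ_β` is nonzero on a punctured neighbourhood of such a point. -/
lemma eventually_phiB_ne_zero {a₃ β ω₀ : ℝ} (ha₃ : 0 < a₃) (hs : Real.sin (ω₀ * a₃) = 0)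
    (hn : Real.cos (ω₀ * a₃) - Real.cos β ≠ 0) :
    ∀ᶠ ω in 𝓝[≠] ω₀, phiB a₃ β ω ≠ 0 := by
  have hd : HasDerivAt (fun ω => Real.sin (ω * a₃)) (Real.cos (ω₀ * a₃) * a₃) ω₀ := by
    simpa using ((hasDerivAt_id ω₀).mul_const a₃).sin
  have hcos : Real.cos (ω₀ * a₃) ≠ 0 := fun hc => by
    simpa [hs, hc] using Real.sin_sq_add_cos_sq (ω₀ * a₃)
  have h1 := hd.eventually_ne (c := 0) (mul_ne_zero hcos ha₃.ne')
  have hcont : ContinuousAt (fun ω => Real.cos (ω * a₃) - Real.cos β) ω₀ := by fun_prop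
  filter_upwards [h1, (hcont.eventually_ne hn).filter_mono nhdsWithin_le_nhds] with ω h2 h3
  exact div_ne_zero h3 h2

lemma div_sub_eq_inv {c x : ℝ} (hc : c ≠ 0) : c / (c - x) = (1 - c⁻¹ * x)⁻¹ := by
  rw [← inv_div]
  congr 1
  field_simp

/-- `I_β → 1` wherever `φ_β` blows up while `f` stays bounded. -/
lemma tendsto_IB {a₁ a₂ a₃ β ω₀ : ℝ} (ha₃ : 0 < a₃) (h₁ : Real.sin (ω₀ * a₁) ≠ 0)
    (h₂ : Real.sin (ω₀ * a₂) ≠ 0) (hs : Real.sin (ω₀ * a₃) = 0)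
    (hn : Real.cos (ω₀ * a₃) - Real.cos β ≠ 0) :
    Tendsto (IB a₁ a₂ a₃ β) (𝓝[≠] ω₀) (𝓝 1) := by
  set B : ℝ → ℝ := fun ω => 2 / |Real.sin (ω * a₁)| + 2 / |Real.sin (ω * a₂)|
  have hBc : ContinuousAt B ω₀ := by
    have key : ∀ a : ℝ, Real.sin (ω₀ * a) ≠ 0 →
        ContinuousAt (fun ω => 2 / |Real.sin (ω * a)|) ω₀ := fun a h =>
      ContinuousAt.div continuousAt_const (by fun_prop) (abs_ne_zero.mpr h)
    exact (key a₁ h₁).add (key a₂ h₂)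
  have hψ := tendsto_inv_phiB hs hn
  have hψB : Tendsto (fun ω => |(phiB a₃ β ω)⁻¹| * B ω) (𝓝[≠] ω₀) (𝓝 0) := by
    have := (hψ.abs.mul hBc.tendsto).mono_left (nhdsWithin_le_nhds (s := {ω₀}ᶜ))
    simpa using this
  have hbound : ∀ ω (p : ℝ × ℝ),
      |(phiB a₃ β ω)⁻¹ * fFun a₁ a₂ p.1 p.2 ω| ≤ |(phiB a₃ β ω)⁻¹| * B ω := fun ω p => by
    rw [abs_mul]
    exact mul_le_mul_of_nonneg_left (abs_fFun_le ..) (abs_nonneg _)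
  have hne := eventually_phiB_ne_zero (β := β) ha₃ hs hn
  have hvol : volume ((Ioo (0 : ℝ) (2 * π)) ×ˢ (Ioo (0 : ℝ) (2 * π))) =
      ENNReal.ofReal (4 * π ^ 2) := by
    rw [Measure.volume_eq_prod, Measure.prod_prod, Real.volume_Ioo,
      ← ENNReal.ofReal_mul (by linarith [Real.pi_pos])]
    congr 1
    ring
  have hlim : Tendsto (fun ω => ∫ p in (Ioo (0 : ℝ) (2 * π)) ×ˢ (Ioo (0 : ℝ) (2 * π)),
      phiB a₃ β ω / (phiB a₃ β ω - fFun a₁ a₂ p.1 p.2 ω)) (𝓝[≠] ω₀)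
      (𝓝 (∫ _ in (Ioo (0 : ℝ) (2 * π)) ×ˢ (Ioo (0 : ℝ) (2 * π)), (1 : ℝ))) := by
    refine tendsto_integral_filter_of_dominated_convergence (fun _ => 2) ?_ ?_ ?_ ?_
    · exact Eventually.of_forall fun ω => (measurable_integrand ..).aestronglyMeasurable
    · filter_upwards [hne, hψB.eventually_lt_const (show (0 : ℝ) < 1 / 2 by norm_num)]
        with ω h0 hlt
      refine Eventually.of_forall fun p => ?_
      have h3 := abs_le.mp ((hbound ω p).trans hlt.le)
      rw [div_sub_eq_inv h0, Real.norm_eq_abs, abs_inv,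
        abs_of_pos (by linarith [h3.2])]
      exact inv_le_of_inv_le₀ (by norm_num) (by linarith [h3.2])
    · refine integrableOn_const ?_
      rw [hvol]
      exact ENNReal.ofReal_ne_top
    · refine Eventually.of_forall fun p => ?_
      have h4 : Tendsto (fun ω => (phiB a₃ β ω)⁻¹ * fFun a₁ a₂ p.1 p.2 ω) (𝓝[≠] ω₀)
          (𝓝 0) := squeeze_zero_norm (fun ω => hbound ω p) hψB
      have h5 := (h4.const_sub 1).inv₀ (by norm_num)
      rw [sub_zero, inv_one] at h5
      refine h5.congr' ?_
      filter_upwards [hne] with ω h0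
      rw [div_sub_eq_inv h0]
  have hval : (∫ _ in (Ioo (0 : ℝ) (2 * π)) ×ˢ (Ioo (0 : ℝ) (2 * π)), (1 : ℝ)) =
      4 * π ^ 2 := by
    rw [setIntegral_const, measureReal_def, hvol, ENNReal.toReal_ofReal (by positivity),
      smul_eq_mul, mul_one]
  rw [hval] at hlim
  have h6 := hlim.const_mul (1 / (4 * π ^ 2))
  rwa [one_div_mul_cancel (by positivity)] at h6

/-- in a gap of type (i), `F_β → 1` at the distinguished point `ω₀`. -/
theorem stmt10 (a₁ a₂ a₃ β : ℝ) (ha₁ : 0 < a₁) (ha₂ : 0 < a₂) (ha₃ : 0 < a₃)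
    (hβ : β ∈ Icc (0 : ℝ) π) (ωb ωt ω₀ : ℝ) (hgap : IsGap a₁ a₂ a₃ β ωb ωt)
    (hb : ωb ∉ Tset a₁ a₂) (ht : ωt ∉ Tset a₁ a₂)
    (hω₀ : ω₀ ∈ Ioo ωb ωt ∩ Wset a₃ β)
    (huniq : ∀ ω ∈ Ioo ωb ωt ∩ Wset a₃ β, ω = ω₀) :
    Tendsto (fun ω => FB a₁ a₂ a₃ β ω) (𝓝[Ioo ωb ωt \ {ω₀}] ω₀) (𝓝 1) ∧
    Tendsto (fun ω => 1 - FB a₁ a₂ a₃ β ω) (𝓝[Ioo ωb ωt \ {ω₀}] ω₀) (𝓝 0) := by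
  have hnot : ω₀ ∉ dispSet a₁ a₂ a₃ β := fun h =>
    (hgap.2.2.2.2 ▸ (⟨hω₀.1, h⟩ : ω₀ ∈ Ioo ωb ωt ∩ dispSet a₁ a₂ a₃ β) :
      ω₀ ∈ (∅ : Set ℝ))
  obtain ⟨h₁, h₂⟩ := sin_ne_zero_of_notMem_dispSet (hgap.1.trans hω₀.1.1) hnot
  obtain ⟨hs, hn⟩ := sin_eq_zero_of_mem_Wset ha₃ hβ hω₀.2
  have hF : Tendsto (fun ω => FB a₁ a₂ a₃ β ω) (𝓝[Ioo ωb ωt \ {ω₀}] ω₀) (𝓝 1) := by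
    have h := ((tendsto_IB ha₃ h₁ h₂ hs hn).inv₀ one_ne_zero).mono_left
      (nhdsWithin_mono ω₀ (show Ioo ωb ωt \ {ω₀} ⊆ {ω₀}ᶜ from fun _ hx => hx.2))
    rwa [inv_one] at h
  exact ⟨hF, by simpa using hF.const_sub 1⟩
end
end
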